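/- There is a constant C such that for all sufficiently smooth u, v on the torus O, ||b(u,v)||_{L^2} ≤ C min( ||u||_{H^3} ||v||_{H^1}, ||u||_{H^1} ||v||_{H^3} ), where b(u,v) = (u·∇_2)v − (∫_{-h}^z div_2 u dξ) ∂_z v. -/

import Mathlib

open MeasureTheory intervalIntegral

/-- The fundamental domain of the torus `O = T_L² × T_h`. -/
def torusBox (L h : ℝ) : Set (ℝ × ℝ × ℝ) :=
  Set.Icc (0:ℝ) L ×ˢ Set.Icc (0:ℝ) L ×ˢ Set.Icc (-h) (0:ℝ)

/-- Periodicity on the torus. -/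
def torusPeriodic (L h : ℝ) (v : ℝ × ℝ × ℝ → ℝ × ℝ) : Prop :=
  (∀ ζ : ℝ × ℝ × ℝ, v (ζ.1 + L, ζ.2.1, ζ.2.2) = v ζ) ∧
  (∀ ζ : ℝ × ℝ × ℝ, v (ζ.1, ζ.2.1 + L, ζ.2.2) = v ζ) ∧
  (∀ ζ : ℝ × ℝ × ℝ, v (ζ.1, ζ.2.1, ζ.2.2 + h) = v ζ)

/-- Horizontal divergence. -/
noncomputable def div2' (u : ℝ × ℝ × ℝ → ℝ × ℝ) (ζ : ℝ × ℝ × ℝ) : ℝ :=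
  (fderiv ℝ u ζ (1, 0, 0)).1 + (fderiv ℝ u ζ (0, 1, 0)).2

/-- The primitive-equations nonlinearity
`b(u,v) = (u·∇₂)v − (∫_{-h}^z div₂ u dξ) ∂_z v`. -/
noncomputable def bPE' (h : ℝ) (u v : ℝ × ℝ × ℝ → ℝ × ℝ) (ζ : ℝ × ℝ × ℝ) : ℝ × ℝ :=
  (u ζ).1 • fderiv ℝ v ζ (1, 0, 0) + (u ζ).2 • fderiv ℝ v ζ (0, 1, 0)
    - (∫ ξ in (-h)..ζ.2.2, div2' u (ζ.1, ζ.2.1, ξ)) • fderiv ℝ v ζ (0, 0, 1)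

/-- `L²(O)` norm. -/
noncomputable def l2Norm {α : Type*} [NormedAddCommGroup α]
    (L h : ℝ) (f : ℝ × ℝ × ℝ → α) : ℝ :=
  (∫ ζ in torusBox L h, ‖f ζ‖ ^ 2) ^ (1/2 : ℝ)

/-- Sobolev `H^j(O)` norm. -/
noncomputable def sobNorm (L h : ℝ) (j : ℕ) (v : ℝ × ℝ × ℝ → ℝ × ℝ) : ℝ :=
  (∑ i ∈ Finset.range (j + 1),
      ∫ ζ in torusBox L h, ‖iteratedFDeriv ℝ i v ζ‖ ^ 2) ^ (1/2 : ℝ)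

section helpers
set_option maxSynthPendingDepth 3

lemma cs_sq {α : Type*} [MeasurableSpace α] (μ : Measure α) [IsFiniteMeasure μ] (g : α → ℝ)
    (hg : Integrable g μ) (hg2 : Integrable (fun x => g x ^ 2) μ) :
    (∫ x, g x ∂μ) ^ 2 ≤ μ.real Set.univ * ∫ x, g x ^ 2 ∂μ := by
  set V := μ.real Set.univ with hV
  set I := ∫ x, g x ∂μ with hI
  have hV0 : 0 ≤ V := measureReal_nonneg
  have h1 : 0 ≤ ∫ x, (V * g x - I) ^ 2 ∂μ := integral_nonneg fun x => sq_nonneg _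
  have h2 : ∫ x, (V * g x - I) ^ 2 ∂μ = V ^ 2 * (∫ x, g x ^ 2 ∂μ) - 2 * V * I * I + V * I ^ 2 := by
    have : (fun x => (V * g x - I) ^ 2) = fun x => V ^ 2 * g x ^ 2 - 2 * V * I * g x + I ^ 2 := by
      ext x; ring
    rw [this, MeasureTheory.integral_add, MeasureTheory.integral_sub, MeasureTheory.integral_const_mul, MeasureTheory.integral_const_mul, MeasureTheory.integral_const]
    · rw [← hI, ← hV, smul_eq_mul]
    · exact hg2.const_mul _
    · exact hg.const_mul _
    · exact (hg2.const_mul _).sub (hg.const_mul _)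
    · exact integrable_const _
  rw [h2] at h1
  rcases hV0.eq_or_lt with h0 | h0
  · have : μ = 0 := by
      have : μ.real Set.univ = 0 := by rw [← hV, ← h0]
      rw [measureReal_eq_zero_iff] at this
      exact Measure.measure_univ_eq_zero.mp this
    rw [hI, this]; simp
  · have : 0 ≤ V * (V * (∫ x, g x ^ 2 ∂μ) - I ^ 2) := by nlinarith
    have := nonneg_of_mul_nonneg_right this h0
    linarith

lemma torusBox_compact (L h : ℝ) : IsCompact (torusBox L h) :=
  isCompact_Icc.prod (isCompact_Icc.prod isCompact_Icc)

lemma torusBox_convex (L h : ℝ) : Convex ℝ (torusBox L h) :=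
  (convex_Icc _ _).prod ((convex_Icc _ _).prod (convex_Icc _ _))

lemma torusBox_vol (L h : ℝ) (hL : 0 < L) (hh : 0 < h) :
    0 < volume.real (torusBox L h) := by
  rw [torusBox, Measure.volume_eq_prod, measureReal_prod_prod, Measure.volume_eq_prod, measureReal_prod_prod]
  simp [hL.le, hh.le]; positivity

lemma haar3 : (volume : Measure (ℝ × ℝ × ℝ)).IsAddHaarMeasure := by
  have h2 : (volume : Measure (ℝ × ℝ)).IsAddHaarMeasure := by
    rw [Measure.volume_eq_prod]; infer_instance
  rw [Measure.volume_eq_prod]; infer_instance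

lemma scale_le {K : Set (ℝ × ℝ × ℝ)} (hK : IsCompact K) (hc : Convex ℝ K) (G : ℝ × ℝ × ℝ → ℝ)
    (hG : Continuous G) (hG0 : ∀ y, 0 ≤ G y) (x : ℝ × ℝ × ℝ) (hx : x ∈ K) (t : ℝ) (ht : 0 < t)
    (ht1 : t ≤ 1) :
    ∫ y in K, G (x + t • (y - x)) ≤ (t ^ 3)⁻¹ * ∫ y in K, G y := by
  have := haar3
  have e : ∀ y : ℝ × ℝ × ℝ, x + t • (y - x) = (x - t • x) + t • y := by
    intro y; rw [smul_sub]; abel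
  simp only [e]
  rw [← MeasureTheory.integral_indicator hK.measurableSet, ← MeasureTheory.integral_indicator hK.measurableSet]
  have hint : Integrable (K.indicator G) :=
    (integrable_indicator_iff hK.measurableSet).2 (hG.continuousOn.integrableOn_compact hK)
  have hA : ∫ y, K.indicator G ((x - t • x) + t • y) = (t ^ 3)⁻¹ * ∫ y, K.indicator G y := by
    rw [Measure.integral_comp_smul volume (fun z => K.indicator G ((x - t • x) + z)) t,
      integral_add_left_eq_self]
    simp [abs_of_pos ht]
  rw [← hA]
  refine integral_mono_of_nonneg ?_ ?_ ?_
  · exact Filter.Eventually.of_forall fun y => Set.indicator_nonneg (fun _ _ => hG0 _) _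
  · exact ((hint.comp_add_left (x - t • x)).comp_smul ht.ne')
  · refine Filter.Eventually.of_forall fun y => ?_
    simp only
    by_cases hy : y ∈ K
    · rw [Set.indicator_of_mem hy, Set.indicator_of_mem]
      rw [← e]
      exact hc.add_smul_sub_mem hx hy ⟨ht.le, ht1⟩
    · rw [Set.indicator_of_notMem hy]
      exact Set.indicator_nonneg (fun _ _ => hG0 _) _

lemma taylor_bd {F : Type*} [NormedAddCommGroup F] [NormedSpace ℝ F] [CompleteSpace F]
    (f : ℝ × ℝ × ℝ → F) (hf : ContDiff ℝ 2 f) (x y : ℝ × ℝ × ℝ) (R : ℝ) (hR : ‖y - x‖ ≤ R) :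
    ‖f x‖ ≤ ‖f y‖ + R * ‖fderiv ℝ f y‖ +
      R ^ 2 * ∫ t in (0:ℝ)..1, t * ‖fderiv ℝ (fderiv ℝ f) (x + t • (y - x))‖ := by
  set d := y - x with hd
  have hR0 : 0 ≤ R := (norm_nonneg _).trans hR
  have h1 : ContDiff ℝ 1 (fderiv ℝ f) := hf.fderiv_right (by norm_num)
  have h2 : Continuous (fderiv ℝ (fderiv ℝ f)) := h1.continuous_fderiv (by norm_num)
  have hl : ∀ t : ℝ, HasDerivAt (fun t : ℝ => x + t • d) d t := by
    intro t
    simpa using ((hasDerivAt_id t).smul_const d).const_add x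
  have hdv : ∀ t : ℝ, HasDerivAt (fun t : ℝ => f (x + t • d) - t • fderiv ℝ f (x + t • d) d)
      (-(t • fderiv ℝ (fderiv ℝ f) (x + t • d) d d)) t := by
    intro t
    have a := ((hf.differentiable (by norm_num)) (x + t • d)).hasFDerivAt.comp_hasDerivAt t (hl t)
    have b := ((h1.differentiable (by norm_num)) (x + t • d)).hasFDerivAt.comp_hasDerivAt t (hl t)
    have b' := b.clm_apply (hasDerivAt_const t d)
    have c := (hasDerivAt_id t).smul b'
    have e : -(t • fderiv ℝ (fderiv ℝ f) (x + t • d) d d) = fderiv ℝ f (x + t • d) d -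
        (t • (fderiv ℝ (fderiv ℝ f) (x + t • d) d d + fderiv ℝ f (x + t • d) 0) +
          (1:ℝ) • fderiv ℝ f (x + t • d) d) := by
      rw [map_zero, add_zero, one_smul]; abel
    rw [e]
    exact a.sub c
  have hcont : Continuous fun t : ℝ => -(t • fderiv ℝ (fderiv ℝ f) (x + t • d) d d) := by
    fun_prop
  have key := integral_eq_sub_of_hasDerivAt (a := 0) (b := 1) (fun t _ => hdv t)
    (hcont.intervalIntegrable _ _)
  have hxy : x + d = y := by rw [hd]; abel
  simp only [one_smul, zero_smul, add_zero, sub_zero, hxy] at key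
  have hfx : f x = f y - fderiv ℝ f y d - ∫ t in (0:ℝ)..1, -(t • fderiv ℝ (fderiv ℝ f) (x + t • d) d d) := by
    rw [key]; abel
  have hI : ‖∫ t in (0:ℝ)..1, -(t • fderiv ℝ (fderiv ℝ f) (x + t • d) d d)‖ ≤
      R ^ 2 * ∫ t in (0:ℝ)..1, t * ‖fderiv ℝ (fderiv ℝ f) (x + t • d)‖ := by
    rw [← intervalIntegral.integral_const_mul]
    refine norm_integral_le_of_norm_le zero_le_one ?_ ?_
    · refine Filter.Eventually.of_forall fun t ht => ?_
      rw [norm_neg, norm_smul, Real.norm_of_nonneg ht.1.le]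
      have : ‖fderiv ℝ (fderiv ℝ f) (x + t • d) d d‖ ≤ ‖fderiv ℝ (fderiv ℝ f) (x + t • d)‖ * R * R := by
        refine (ContinuousLinearMap.le_opNorm₂ _ _ _).trans ?_
        gcongr
      calc _ ≤ t * (‖fderiv ℝ (fderiv ℝ f) (x + t • d)‖ * R * R) := by
            gcongr; exact ht.1.le
        _ = _ := by ring
    · have h3 := h2.norm
      have h4 : Continuous fun t : ℝ => ‖fderiv ℝ (fderiv ℝ f) (x + t • d)‖ :=
        h3.comp (by fun_prop)
      exact Continuous.intervalIntegrable (continuous_const.mul (continuous_id.mul h4)) _ _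
  have hD : ‖fderiv ℝ f y d‖ ≤ R * ‖fderiv ℝ f y‖ := by
    refine (ContinuousLinearMap.le_opNorm _ _).trans ?_
    rw [mul_comm]; gcongr
  rw [hfx]
  refine (norm_sub_le _ _).trans ?_
  refine add_le_add ((norm_sub_le _ _).trans ?_) hI
  gcongr

lemma sob_aux {K : Set (ℝ × ℝ × ℝ)} (hK : IsCompact K) (hc : Convex ℝ K) (G : ℝ × ℝ × ℝ → ℝ)
    (hG : Continuous G) (hG0 : ∀ y, 0 ≤ G y) (x : ℝ × ℝ × ℝ) (hx : x ∈ K) :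
    ∫ y in K, ∫ t in (0:ℝ)..1, t * G (x + t • (y - x)) ≤
      2 * √(volume.real K * ∫ y in K, G y ^ 2) := by
  have : IsFiniteMeasure (volume.restrict K) := ⟨by simpa using hK.measure_lt_top⟩
  set S := √(volume.real K * ∫ y in K, G y ^ 2) with hS
  simp only [integral_of_le zero_le_one]
  have hsw : ∫ y in K, ∫ t in Set.Ioc (0:ℝ) 1, t * G (x + t • (y - x)) =
      ∫ t in Set.Ioc (0:ℝ) 1, ∫ y in K, t * G (x + t • (y - x)) := by
    refine integral_integral_swap ?_
    rw [Measure.prod_restrict]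
    have : Continuous (Function.uncurry fun (y : ℝ × ℝ × ℝ) (t : ℝ) => t * G (x + t • (y - x))) := by
      unfold Function.uncurry; fun_prop
    exact (this.continuousOn.integrableOn_compact (hK.prod isCompact_Icc)).mono_set
      (Set.prod_mono_right Set.Ioc_subset_Icc_self)
  rw [hsw]
  have hr : IntervalIntegrable (fun t : ℝ => S * t ^ (-(1/2) : ℝ)) volume 0 1 :=
    (intervalIntegrable_rpow' (by norm_num)).const_mul _
  have hval : ∫ t in Set.Ioc (0:ℝ) 1, S * t ^ (-(1/2) : ℝ) = 2 * S := by
    rw [← integral_of_le zero_le_one, intervalIntegral.integral_const_mul, integral_rpow (by norm_num)]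
    norm_num; ring
  rw [← hval]
  refine integral_mono_of_nonneg ?_ ?_ ?_
  · refine (ae_restrict_iff' measurableSet_Ioc).2 (Filter.Eventually.of_forall fun t ht => ?_)
    exact integral_nonneg fun y => mul_nonneg ht.1.le (hG0 _)
  · exact (intervalIntegrable_iff_integrableOn_Ioc_of_le zero_le_one).1 hr
  · refine (ae_restrict_iff' measurableSet_Ioc).2 (Filter.Eventually.of_forall fun t ht => ?_)
    simp only
    rw [MeasureTheory.integral_const_mul]
    have ht0 := ht.1
    have c1 : Continuous fun y => G (x + t • (y - x)) := by fun_prop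
    have b1 := cs_sq (volume.restrict K) (fun y => G (x + t • (y - x)))
      (c1.continuousOn.integrableOn_compact hK) ((c1.pow 2).continuousOn.integrableOn_compact hK)
    have b2 := scale_le hK hc (fun y => G y ^ 2) (hG.pow 2) (fun y => sq_nonneg _) x hx t ht.1 ht.2
    simp only [measureReal_restrict_apply_univ] at b1
    have hS2 : S ^ 2 = volume.real K * ∫ y in K, G y ^ 2 :=
      Real.sq_sqrt (mul_nonneg measureReal_nonneg (integral_nonneg fun y => sq_nonneg _))
    have hS0 : 0 ≤ S := Real.sqrt_nonneg _
    refine le_of_sq_le_sq ?_ (by positivity) 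
    rw [mul_pow, mul_pow, hS2, ← Real.rpow_natCast (t ^ (-(1/2) : ℝ)), ← Real.rpow_mul ht0.le]
    norm_num [Real.rpow_neg_one]
    calc t ^ 2 * (∫ y in K, G (x + t • (y - x))) ^ 2 
        ≤ t ^ 2 * (volume.real K * ((t ^ 3)⁻¹ * ∫ y in K, G y ^ 2)) := by
          gcongr
          exact b1.trans (by gcongr)
      _ = _ := by field_simp

lemma sobolev {K : Set (ℝ × ℝ × ℝ)} (hK : IsCompact K) (hc : Convex ℝ K) (hV : 0 < volume.real K)
    (R : ℝ) (hR : ∀ x ∈ K, ∀ y ∈ K, ‖y - x‖ ≤ R) : ∃ C > 0, 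
    ∀ (F : Type) [NormedAddCommGroup F] [NormedSpace ℝ F] [CompleteSpace F]
    (f : ℝ × ℝ × ℝ → F), ContDiff ℝ 2 f → ∀ x ∈ K, ‖f x‖ ^ 2 ≤ C * 
     ((∫ y in K, ‖f y‖ ^ 2) + (∫ y in K, ‖fderiv ℝ f y‖ ^ 2) + 
      ∫ y in K, ‖fderiv ℝ (fderiv ℝ f) y‖ ^ 2) := by
  have : IsFiniteMeasure (volume.restrict K) := ⟨by simpa using hK.measure_lt_top⟩
  set V := volume.real K with hVd
  refine ⟨3 * (1 + R ^ 2 + 4 * R ^ 4) / V, by positivity, ?_⟩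
  intro F _ _ _ f hf x hx
  have h1 : ContDiff ℝ 1 (fderiv ℝ f) := hf.fderiv_right (by norm_num)
  have h2 : Continuous (fderiv ℝ (fderiv ℝ f)) := h1.continuous_fderiv (by norm_num)
  have h0c := hf.continuous
  have h1c := h1.continuous
  have io : ∀ g : ℝ × ℝ × ℝ → ℝ, Continuous g → IntegrableOn g K := fun g hg =>
    hg.continuousOn.integrableOn_compact hK
  have cI : Continuous fun y => ∫ t in (0:ℝ)..1, t * ‖fderiv ℝ (fderiv ℝ f) (x + t • (y - x))‖ := by
    apply intervalIntegral.continuous_parametric_intervalIntegral_of_continuous'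
    have h4 : Continuous fun p : (ℝ × ℝ × ℝ) × ℝ =>
        ‖fderiv ℝ (fderiv ℝ f) (x + p.2 • (p.1 - x))‖ := h2.norm.comp (by fun_prop)
    exact continuous_snd.mul h4
  set A0 := ∫ y in K, ‖f y‖ ^ 2
  set A1 := ∫ y in K, ‖fderiv ℝ f y‖ ^ 2
  set A2 := ∫ y in K, ‖fderiv ℝ (fderiv ℝ f) y‖ ^ 2
  have p0 : 0 ≤ A0 := integral_nonneg fun y => sq_nonneg _
  have p1 : 0 ≤ A1 := integral_nonneg fun y => sq_nonneg _
  have p2 : 0 ≤ A2 := integral_nonneg fun y => sq_nonneg _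
  have m : V * ‖f x‖ ≤ (∫ y in K, ‖f y‖) + R * (∫ y in K, ‖fderiv ℝ f y‖) +
      R ^ 2 * ∫ y in K, ∫ t in (0:ℝ)..1, t * ‖fderiv ℝ (fderiv ℝ f) (x + t • (y - x))‖ := by
    rw [← MeasureTheory.integral_const_mul, ← MeasureTheory.integral_const_mul, ← MeasureTheory.integral_add, ← MeasureTheory.integral_add]
    · have : V * ‖f x‖ = ∫ y in K, ‖f x‖ := by simp [hVd]
      rw [this]
      refine setIntegral_mono_on (io _ continuous_const) (io _ ?_) hK.measurableSet ?_
      · fun_prop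
      · intro y hy
        exact taylor_bd f hf x y R (hR x hx y hy)
    · exact io _ (by fun_prop)
    · exact io _ (by fun_prop)
    · exact io _ (by fun_prop)
    · exact io _ (by fun_prop)
  have q0 := cs_sq (volume.restrict K) (fun y => ‖f y‖) (io _ (by fun_prop)) (io _ (by fun_prop))
  have q1 := cs_sq (volume.restrict K) (fun y => ‖fderiv ℝ f y‖) (io _ (by fun_prop)) (io _ (by fun_prop))
  have q2 := sob_aux hK hc (fun y => ‖fderiv ℝ (fderiv ℝ f) y‖) h2.norm
    (fun y => norm_nonneg (fderiv ℝ (fderiv ℝ f) y)) x hx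
  simp only [measureReal_restrict_apply_univ] at q0 q1
  set B0 := ∫ y in K, ‖f y‖
  set B1 := ∫ y in K, ‖fderiv ℝ f y‖
  set B2 := ∫ y in K, ∫ t in (0:ℝ)..1, t * ‖fderiv ℝ (fderiv ℝ f) (x + t • (y - x))‖
  have r2 : B2 ^ 2 ≤ 4 * (V * A2) := by
    have r0 : 0 ≤ B2 := integral_nonneg fun y => by
      refine intervalIntegral.integral_nonneg zero_le_one fun t ht => mul_nonneg ht.1 (norm_nonneg _)
    calc B2 ^ 2 ≤ (2 * √(V * A2)) ^ 2 := by gcongr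
      _ = _ := by rw [mul_pow, Real.sq_sqrt (by positivity)]; norm_num
  have s : V ^ 2 * ‖f x‖ ^ 2 ≤ V * (3 * (1 + R ^ 2 + 4 * R ^ 4) * (A0 + A1 + A2)) := by
    calc V ^ 2 * ‖f x‖ ^ 2 = (V * ‖f x‖) ^ 2 := by ring
      _ ≤ (B0 + R * B1 + R ^ 2 * B2) ^ 2 := by gcongr
      _ ≤ 3 * (B0 ^ 2 + R ^ 2 * B1 ^ 2 + R ^ 4 * B2 ^ 2) := by
        nlinarith [sq_nonneg (B0 - R * B1), sq_nonneg (B0 - R ^ 2 * B2), sq_nonneg (R * B1 - R ^ 2 * B2)]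
      _ ≤ 3 * (V * A0 + R ^ 2 * (V * A1) + R ^ 4 * (4 * (V * A2))) := by gcongr
      _ = V * (3 * (A0 + R ^ 2 * A1 + 4 * R ^ 4 * A2)) := by ring
      _ ≤ _ := by
        rw [mul_assoc 3]
        gcongr
        have : 0 ≤ R ^ 2 * A0 := by positivity
        have : 0 ≤ R ^ 4 * A0 := by positivity
        have : 0 ≤ R ^ 4 * A1 := by positivity
        have : 0 ≤ R ^ 2 * A2 := by positivity
        nlinarith
  rw [pow_two V, mul_assoc] at s
  have s' := le_of_mul_le_mul_left s hV
  rw [div_mul_eq_mul_div, le_div_iff₀ hV]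
  linarith

lemma torusBox_diam (L h : ℝ) : ∀ x ∈ torusBox L h, ∀ y ∈ torusBox L h, ‖y - x‖ ≤ max L h := by
  rintro ⟨x1, x2, x3⟩ ⟨⟨a1, a2⟩, ⟨a3, a4⟩, ⟨a5, a6⟩⟩ ⟨y1, y2, y3⟩ ⟨⟨b1, b2⟩, ⟨b3, b4⟩, ⟨b5, b6⟩⟩
  simp only at a1 a2 a3 a4 a5 a6 b1 b2 b3 b4 b5 b6
  have hl := le_max_left L h
  have hr := le_max_right L h
  simp only [Prod.mk_sub_mk, Prod.norm_mk, Real.norm_eq_abs]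
  refine max_le ?_ (max_le ?_ ?_) <;> rw [abs_le] <;> constructor <;> linarith

/-- The squared Sobolev norm. -/
noncomputable def sobSq (L h : ℝ) (j : ℕ) (v : ℝ × ℝ × ℝ → ℝ × ℝ) : ℝ :=
  ∑ i ∈ Finset.range (j + 1), ∫ ζ in torusBox L h, ‖iteratedFDeriv ℝ i v ζ‖ ^ 2

lemma sobSq_nonneg (L h : ℝ) (j : ℕ) (v : ℝ × ℝ × ℝ → ℝ × ℝ) : 0 ≤ sobSq L h j v :=
  Finset.sum_nonneg fun _ _ => integral_nonneg fun _ => sq_nonneg _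

lemma sobSq_one (L h : ℝ) (v : ℝ × ℝ × ℝ → ℝ × ℝ) : sobSq L h 1 v =
    (∫ ζ in torusBox L h, ‖v ζ‖ ^ 2) + ∫ ζ in torusBox L h, ‖fderiv ℝ v ζ‖ ^ 2 := by
  simp [sobSq, Finset.sum_range_succ, norm_iteratedFDeriv_one]

lemma sobSq_three (L h : ℝ) (v : ℝ × ℝ × ℝ → ℝ × ℝ) : sobSq L h 3 v =
    (∫ ζ in torusBox L h, ‖v ζ‖ ^ 2) + (∫ ζ in torusBox L h, ‖fderiv ℝ v ζ‖ ^ 2) +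
    (∫ ζ in torusBox L h, ‖fderiv ℝ (fderiv ℝ v) ζ‖ ^ 2) +
    (∫ ζ in torusBox L h, ‖fderiv ℝ (fderiv ℝ (fderiv ℝ v)) ζ‖ ^ 2) := by
  have e2 : ∀ ζ, ‖iteratedFDeriv ℝ 2 v ζ‖ = ‖fderiv ℝ (fderiv ℝ v) ζ‖ := by
    intro ζ
    rw [← norm_iteratedFDeriv_fderiv, norm_iteratedFDeriv_one]
  have e3 : ∀ ζ, ‖iteratedFDeriv ℝ 3 v ζ‖ = ‖fderiv ℝ (fderiv ℝ (fderiv ℝ v)) ζ‖ := by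
    intro ζ
    rw [← norm_iteratedFDeriv_fderiv, ← norm_iteratedFDeriv_fderiv, norm_iteratedFDeriv_one]
  simp [sobSq, Finset.sum_range_succ, norm_iteratedFDeriv_one, e2, e3]

lemma sob_bds (L h : ℝ) (hL : 0 < L) (hh : 0 < h) : ∃ C > 0, ∀ u : ℝ × ℝ × ℝ → ℝ × ℝ,
    ContDiff ℝ (⊤ : ℕ∞) u → ∀ x ∈ torusBox L h,
    ‖u x‖ ^ 2 ≤ C * sobSq L h 3 u ∧ ‖fderiv ℝ u x‖ ^ 2 ≤ C * sobSq L h 3 u := by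
  obtain ⟨C, hC, H⟩ := sobolev (torusBox_compact L h) (torusBox_convex L h)
    (torusBox_vol L h hL hh) _ (torusBox_diam L h)
  refine ⟨C, hC, fun u hu x hx => ⟨?_, ?_⟩⟩
  · refine (H _ u (contDiff_infty.1 hu 2) x hx).trans ?_
    gcongr
    rw [sobSq_three]
    have : 0 ≤ ∫ ζ in torusBox L h, ‖fderiv ℝ (fderiv ℝ (fderiv ℝ u)) ζ‖ ^ 2 :=
      integral_nonneg fun _ => sq_nonneg _
    linarith
  · have h1 : ContDiff ℝ 2 (fderiv ℝ u) := 
      (contDiff_infty.1 hu 3).fderiv_right (by norm_num)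
    refine (H _ (fderiv ℝ u) h1 x hx).trans ?_
    gcongr
    rw [sobSq_three]
    have : 0 ≤ ∫ ζ in torusBox L h, ‖u ζ‖ ^ 2 :=
      integral_nonneg fun _ => sq_nonneg _
    linarith

lemma bPE_pointwise (L h : ℝ) (hh : 0 < h) (u v : ℝ × ℝ × ℝ → ℝ × ℝ)
    (hu : ContDiff ℝ (⊤ : ℕ∞) u) (ζ : ℝ × ℝ × ℝ) (hζ : ζ ∈ torusBox L h) :
    ‖bPE' h u v ζ‖ ^ 2 ≤ 8 * (‖u ζ‖ ^ 2 +
      h * ∫ ξ in Set.Icc (-h) 0, ‖fderiv ℝ u (ζ.1, ζ.2.1, ξ)‖ ^ 2) * ‖fderiv ℝ v ζ‖ ^ 2 := by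
  have hc : Continuous (fderiv ℝ u) := hu.continuous_fderiv (by simp)
  have hcξ : Continuous fun ξ : ℝ => fderiv ℝ u (ζ.1, ζ.2.1, ξ) := hc.comp (by fun_prop)
  have hz : -h ≤ ζ.2.2 ∧ ζ.2.2 ≤ 0 := hζ.2.2
  have n1 : ‖((1, 0, 0) : ℝ × ℝ × ℝ)‖ = 1 := by simp [Prod.norm_mk]
  have n2 : ‖((0, 1, 0) : ℝ × ℝ × ℝ)‖ = 1 := by simp [Prod.norm_mk]
  have n3 : ‖((0, 0, 1) : ℝ × ℝ × ℝ)‖ = 1 := by simp [Prod.norm_mk]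
  have d : ∀ (w : ℝ × ℝ × ℝ → ℝ × ℝ) (z e : ℝ × ℝ × ℝ), ‖e‖ = 1 →
      ‖fderiv ℝ w z e‖ ≤ ‖fderiv ℝ w z‖ := by
    intro w z e he
    simpa [he] using (fderiv ℝ w z).le_opNorm e
  have hdiv : ∀ z, ‖div2' u z‖ ≤ 2 * ‖fderiv ℝ u z‖ := by
    intro z
    have a := (norm_fst_le _).trans (d u z _ n1)
    have b := (norm_snd_le _).trans (d u z _ n2)
    exact (norm_add_le _ _).trans (by linarith)
  set P := ∫ ξ in Set.Icc (-h) 0, ‖fderiv ℝ u (ζ.1, ζ.2.1, ξ)‖ with hP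
  set Q := ∫ ξ in Set.Icc (-h) 0, ‖fderiv ℝ u (ζ.1, ζ.2.1, ξ)‖ ^ 2 with hQ
  have hP0 : 0 ≤ P := integral_nonneg fun _ => norm_nonneg _
  have hPQ : P ^ 2 ≤ h * Q := by
    have := cs_sq (volume.restrict (Set.Icc (-h) 0)) (fun ξ => ‖fderiv ℝ u (ζ.1, ζ.2.1, ξ)‖)
      (hcξ.norm.continuousOn.integrableOn_compact isCompact_Icc)
      ((hcξ.norm.pow 2).continuousOn.integrableOn_compact isCompact_Icc)
    simpa [hh.le] using this
  have hW : ‖∫ ξ in (-h)..ζ.2.2, div2' u (ζ.1, ζ.2.1, ξ)‖ ≤ 2 * P := by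
    calc _ ≤ ∫ ξ in (-h)..ζ.2.2, 2 * ‖fderiv ℝ u (ζ.1, ζ.2.1, ξ)‖ :=
          norm_integral_le_of_norm_le hz.1 (Filter.Eventually.of_forall fun t _ => hdiv _)
            ((continuous_const.mul hcξ.norm).intervalIntegrable _ _)
      _ = 2 * ∫ ξ in Set.Ioc (-h) ζ.2.2, ‖fderiv ℝ u (ζ.1, ζ.2.1, ξ)‖ := by
          rw [intervalIntegral.integral_const_mul, integral_of_le hz.1]
      _ ≤ 2 * P := by
          gcongr
          refine setIntegral_mono_set (hcξ.norm.continuousOn.integrableOn_compact isCompact_Icc)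
            (Filter.Eventually.of_forall fun _ => norm_nonneg _) (LE.le.eventuallyLE ?_)
          exact fun t ht => ⟨ht.1.le, ht.2.trans hz.2⟩
  have hb : ‖bPE' h u v ζ‖ ≤ (2 * ‖u ζ‖ + 2 * P) * ‖fderiv ℝ v ζ‖ := by
    unfold bPE'
    refine (norm_sub_le _ _).trans ?_
    refine (add_le_add_left (norm_add_le _ _) _).trans ?_
    simp only [norm_smul]
    calc _ ≤ ‖u ζ‖ * ‖fderiv ℝ v ζ‖ + ‖u ζ‖ * ‖fderiv ℝ v ζ‖ + 2 * P * ‖fderiv ℝ v ζ‖ := by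
          gcongr
          · exact norm_fst_le _
          · exact d v ζ _ n1
          · exact norm_snd_le _
          · exact d v ζ _ n2
          · exact d v ζ _ n3
      _ = _ := by ring
  calc ‖bPE' h u v ζ‖ ^ 2 ≤ ((2 * ‖u ζ‖ + 2 * P) * ‖fderiv ℝ v ζ‖) ^ 2 := by gcongr
    _ = (2 * ‖u ζ‖ + 2 * P) ^ 2 * ‖fderiv ℝ v ζ‖ ^ 2 := by ring
    _ ≤ (8 * (‖u ζ‖ ^ 2 + P ^ 2)) * ‖fderiv ℝ v ζ‖ ^ 2 := by
        gcongr
        nlinarith [sq_nonneg (‖u ζ‖ - P)]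
    _ ≤ _ := by gcongr

lemma vert_cont (h : ℝ) (g : ℝ × ℝ × ℝ → ℝ) (hg : Continuous g) :
    Continuous fun ζ : ℝ × ℝ × ℝ => ∫ ξ in Set.Icc (-h) 0, g (ζ.1, ζ.2.1, ξ) := by
  refine continuous_parametric_integral_of_continuous ?_ isCompact_Icc
  unfold Function.uncurry; fun_prop

lemma vert_int (L h : ℝ) (hh : 0 < h) (g : ℝ × ℝ × ℝ → ℝ) (hg : Continuous g) :
    ∫ ζ in torusBox L h, ∫ ξ in Set.Icc (-h) 0, g (ζ.1, ζ.2.1, ξ) =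
      h * ∫ ζ in torusBox L h, g ζ := by
  have key : ∀ f : ℝ × ℝ × ℝ → ℝ, Continuous f → ∫ ζ in torusBox L h, f ζ =
      ∫ x in Set.Icc 0 L, ∫ y in Set.Icc 0 L, ∫ z in Set.Icc (-h) 0, f (x, y, z) := by
    intro f hf
    have i1 := hf.continuousOn.integrableOn_compact (μ := volume) (torusBox_compact L h)
    rw [torusBox, Measure.volume_eq_prod] at i1 ⊢
    rw [setIntegral_prod _ i1]
    congr 1
    ext x
    have c2 : Continuous fun p : ℝ × ℝ => f (x, p) := by fun_prop
    have i2 := c2.continuousOn.integrableOn_compact (μ := volume)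
      ((isCompact_Icc (a := 0) (b := L)).prod (isCompact_Icc (a := -h) (b := 0)))
    rw [Measure.volume_eq_prod] at i2 ⊢
    rw [setIntegral_prod _ i2]
  rw [key _ (vert_cont h g hg), key g hg]
  simp [hh.le, MeasureTheory.integral_const_mul]

lemma bPE_core (L h : ℝ) (hL : 0 < L) (hh : 0 < h) : ∃ c > 0, ∀ u v : ℝ × ℝ × ℝ → ℝ × ℝ,
    ContDiff ℝ (⊤ : ℕ∞) u → ContDiff ℝ (⊤ : ℕ∞) v →
    ∫ ζ in torusBox L h, ‖bPE' h u v ζ‖ ^ 2 ≤ c * (sobSq L h 3 u * sobSq L h 1 v) ∧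
    ∫ ζ in torusBox L h, ‖bPE' h u v ζ‖ ^ 2 ≤ c * (sobSq L h 1 u * sobSq L h 3 v) := by
  obtain ⟨C, hC, H⟩ := sob_bds L h hL hh
  refine ⟨8 * C * (1 + h ^ 2), by positivity, fun u v hu hv => ?_⟩
  have hK := torusBox_compact L h
  have hcu : Continuous fun ζ => ‖fderiv ℝ u ζ‖ ^ 2 :=
    (hu.continuous_fderiv (by simp)).norm.pow 2
  have hcv : Continuous fun ζ => ‖fderiv ℝ v ζ‖ ^ 2 :=
    (hv.continuous_fderiv (by simp)).norm.pow 2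
  have hcu0 : Continuous fun ζ => ‖u ζ‖ ^ 2 := hu.continuous.norm.pow 2
  have p0 := sobSq_nonneg L h 3 u
  have p1 := sobSq_nonneg L h 3 v
  have mono : ∀ g : ℝ × ℝ × ℝ → ℝ, Continuous g →
      (∀ ζ ∈ torusBox L h, ‖bPE' h u v ζ‖ ^ 2 ≤ g ζ) →
      ∫ ζ in torusBox L h, ‖bPE' h u v ζ‖ ^ 2 ≤ ∫ ζ in torusBox L h, g ζ := by
    intro g hg hle
    refine integral_mono_of_nonneg (Filter.Eventually.of_forall fun _ => sq_nonneg _)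
      (hg.continuousOn.integrableOn_compact hK) ?_
    exact (ae_restrict_iff' hK.measurableSet).2 (Filter.Eventually.of_forall hle)
  constructor
  · have := mono (fun ζ => 8 * C * (1 + h ^ 2) * sobSq L h 3 u * ‖fderiv ℝ v ζ‖ ^ 2)
      (continuous_const.mul hcv) ?_
    · refine this.trans ?_
      rw [MeasureTheory.integral_const_mul, mul_assoc]
      gcongr
      rw [sobSq_one]
      have : 0 ≤ ∫ ζ in torusBox L h, ‖v ζ‖ ^ 2 := integral_nonneg fun _ => sq_nonneg _
      linarith
    · intro ζ hζ
      refine (bPE_pointwise L h hh u v hu ζ hζ).trans ?_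
      refine mul_le_mul_of_nonneg_right ?_ (sq_nonneg _)
      have hQ : ∫ ξ in Set.Icc (-h) 0, ‖fderiv ℝ u (ζ.1, ζ.2.1, ξ)‖ ^ 2 ≤ h * (C * sobSq L h 3 u) := by
        have e : h * (C * sobSq L h 3 u) = ∫ ξ in Set.Icc (-h) 0, C * sobSq L h 3 u := by
          simp [hh.le]
        rw [e]
        refine setIntegral_mono_on ?_ ?_ measurableSet_Icc ?_
        · have : Continuous fun ξ : ℝ => ‖fderiv ℝ u (ζ.1, ζ.2.1, ξ)‖ ^ 2 := hcu.comp (by fun_prop)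
          exact this.continuousOn.integrableOn_compact isCompact_Icc
        · exact continuous_const.continuousOn.integrableOn_compact isCompact_Icc
        · intro ξ hξ
          exact (H u hu (ζ.1, ζ.2.1, ξ) ⟨hζ.1, hζ.2.1, hξ⟩).2
      have h0 := (H u hu ζ hζ).1
      calc _ ≤ 8 * (C * sobSq L h 3 u + h * (h * (C * sobSq L h 3 u))) := by gcongr
        _ = _ := by ring
  · have hvc := vert_cont h _ hcu
    have hvc' : Continuous fun ζ : ℝ × ℝ × ℝ =>
        h * ∫ ξ in Set.Icc (-h) 0, ‖fderiv ℝ u (ζ.1, ζ.2.1, ξ)‖ ^ 2 := continuous_const.mul hvc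
    have := mono (fun ζ => 8 * (C * sobSq L h 3 v) * (‖u ζ‖ ^ 2 +
      h * ∫ ξ in Set.Icc (-h) 0, ‖fderiv ℝ u (ζ.1, ζ.2.1, ξ)‖ ^ 2))
      (continuous_const.mul (hcu0.add (continuous_const.mul hvc))) ?_
    · refine this.trans ?_
      rw [MeasureTheory.integral_const_mul, MeasureTheory.integral_add
        (hcu0.continuousOn.integrableOn_compact hK)
        (hvc'.continuousOn.integrableOn_compact hK),
        MeasureTheory.integral_const_mul, vert_int L h hh _ hcu, sobSq_one]
      set a := ∫ ζ in torusBox L h, ‖u ζ‖ ^ 2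
      set b := ∫ ζ in torusBox L h, ‖fderiv ℝ u ζ‖ ^ 2
      have ha : 0 ≤ a := integral_nonneg fun _ => sq_nonneg _
      have hb : 0 ≤ b := integral_nonneg fun _ => sq_nonneg _
      calc _ ≤ 8 * (C * sobSq L h 3 v) * ((1 + h ^ 2) * (a + b)) := by
            gcongr
            nlinarith [mul_nonneg (sq_nonneg h) ha]
        _ = _ := by ring
    · intro ζ hζ
      refine (bPE_pointwise L h hh u v hu ζ hζ).trans ?_
      have h1 := (H v hv ζ hζ).2
      have hq : 0 ≤ ∫ ξ in Set.Icc (-h) 0, ‖fderiv ℝ u (ζ.1, ζ.2.1, ξ)‖ ^ 2 :=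
        integral_nonneg fun _ => sq_nonneg _
      calc _ ≤ 8 * (‖u ζ‖ ^ 2 + h * ∫ ξ in Set.Icc (-h) 0, ‖fderiv ℝ u (ζ.1, ζ.2.1, ξ)‖ ^ 2)
            * (C * sobSq L h 3 v) := by gcongr
        _ = _ := by ring

lemma root_le {X c A B : ℝ} (hA : 0 ≤ A) (hc : 0 ≤ c)
    (hX : X ≤ c * (A * B)) :
    X ^ (1/2 : ℝ) ≤ √c * (A ^ (1/2 : ℝ) * B ^ (1/2 : ℝ)) := by
  rw [← Real.sqrt_eq_rpow, ← Real.sqrt_eq_rpow, ← Real.sqrt_eq_rpow, ← Real.sqrt_mul hA,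
    ← Real.sqrt_mul hc]
  exact Real.sqrt_le_sqrt hX

end helpers

/-- `‖b(u,v)‖_{L²} ≤ C min(‖u‖_{H³}‖v‖_{H¹}, ‖u‖_{H¹}‖v‖_{H³})`. -/
theorem bPE_L2_estimate (L h : ℝ) (hL : 0 < L) (hh : 0 < h) :
    ∃ C > 0, ∀ u v : ℝ × ℝ × ℝ → ℝ × ℝ,
      ContDiff ℝ (⊤ : ℕ∞) u → ContDiff ℝ (⊤ : ℕ∞) v →
      torusPeriodic L h u → torusPeriodic L h v →
      l2Norm L h (bPE' h u v)
        ≤ C * min (sobNorm L h 3 u * sobNorm L h 1 v)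
                  (sobNorm L h 1 u * sobNorm L h 3 v) := by
  obtain ⟨c, hc, H⟩ := bPE_core L h hL hh
  refine ⟨√c, Real.sqrt_pos.2 hc, fun u v hu hv _ _ => ?_⟩
  rw [mul_min_of_nonneg _ _ (Real.sqrt_nonneg c)]
  exact le_min (root_le (sobSq_nonneg L h 3 u) hc.le (H u v hu hv).1)
    (root_le (sobSq_nonneg L h 1 u) hc.le (H u v hu hv).2)
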